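/- (BF error bound.) Assume b_j − ε_j ≤ (A η)_j ≤ b_j + ε_j for every j, and let g^{bf} ∈ Δ_k^n attain sup_{g ∈ Δ_k^n} inf_{z ∈ P(b,ε)} z·log g. Then for every θ^{ref} ∈ ℝ^m: d(η, g^{bf}) ≤ −( inf_{z ∈ P(b,ε)} z·log z ) + η·log η ≤ d(η, g^{(θ^{ref})}) + 2 Σ_{j=1}^m ε_j·|θ^{ref}_j| ≤ d(η, g^{(θ^{ref})}) + 2·(max_j ε_j)·(Σ_j |θ^{ref}_j|). -/

import Mathlib

open Finset

attribute [local instance] Classical.propDecidable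

noncomputable section

/-- The simplex `Δ_k^n`: rows are probability distributions over `Fin k`. -/
def Simplex (n k : ℕ) : Set (Fin n → Fin k → ℝ) :=
  {z | (∀ i ℓ, 0 ≤ z i ℓ) ∧ ∀ i, ∑ ℓ, z i ℓ = 1}

/-- Number of points where rule `j` does not abstain. -/
def nRule {n k p : ℕ} (h : Fin p → Fin n → Option (Fin k)) (j : Fin p) : ℕ :=
  (Finset.univ.filter (fun i => h j i ≠ none)).card

/-- The constraint matrix `A`, with `m = p + k` rows indexed by `Fin p ⊕ Fin k`. -/
def Amat {n k p : ℕ} (h : Fin p → Fin n → Option (Fin k)) :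
    Fin p ⊕ Fin k → Fin n → Fin k → ℝ
  | Sum.inl j => fun i ℓ => if h j i = some ℓ then 1 / (nRule h j : ℝ) else 0
  | Sum.inr ℓ' => fun i ℓ => if ℓ = ℓ' then 1 / (n : ℝ) else 0

/-- `(A z)_j`. -/
def applyA {n k p : ℕ} (h : Fin p → Fin n → Option (Fin k))
    (z : Fin n → Fin k → ℝ) (j : Fin p ⊕ Fin k) : ℝ :=
  ∑ i, ∑ ℓ, Amat h j i ℓ * z i ℓ

/-- The polytope `P(b, ε)`. -/
def Polytope {n k p : ℕ} (h : Fin p → Fin n → Option (Fin k))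
    (b ε : Fin p ⊕ Fin k → ℝ) : Set (Fin n → Fin k → ℝ) :=
  {z | z ∈ Simplex n k ∧ ∀ j, b j - ε j ≤ applyA h z j ∧ applyA h z j ≤ b j + ε j}

/-- Extended-real logarithm, with `elog 0 = ⊥ = -∞`. -/
def elog (x : ℝ) : EReal := if x = 0 then ⊥ else ((Real.log x : ℝ) : EReal)

/-- `z · log g`, valued in `[-∞, 0]` with the convention `0 · log 0 = 0`. -/
def dotlog {n k : ℕ} (z g : Fin n → Fin k → ℝ) : EReal :=
  ∑ i, ∑ ℓ, (z i ℓ : EReal) * elog (g i ℓ)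

/-- `a^{(θ)}_{iℓ} = Σ_j θ_j · A j i ℓ`. -/
def avec {n k p : ℕ} (h : Fin p → Fin n → Option (Fin k))
    (θ : Fin p ⊕ Fin k → ℝ) (i : Fin n) (ℓ : Fin k) : ℝ :=
  ∑ j, θ j * Amat h j i ℓ

/-- The exponential-family (softmax) prediction `g^{(θ)}`. -/
def gexp {n k p : ℕ} (h : Fin p → Fin n → Option (Fin k))
    (θ : Fin p ⊕ Fin k → ℝ) (i : Fin n) (ℓ : Fin k) : ℝ :=
  Real.exp (avec h θ i ℓ) / ∑ ℓ', Real.exp (avec h θ i ℓ')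

/-- The BF dual objective `(σ'−σ)·b − (σ'+σ)·ε − Σ_i log(Σ_ℓ exp(a^{(σ'−σ)}_{iℓ}))`. -/
def dualObj {n k p : ℕ} (h : Fin p → Fin n → Option (Fin k))
    (b ε σ σ' : Fin p ⊕ Fin k → ℝ) : ℝ :=
  (∑ j, (σ' j - σ j) * b j) - (∑ j, (σ' j + σ j) * ε j)
    - ∑ i, Real.log (∑ ℓ, Real.exp (avec h (fun j => σ' j - σ j) i ℓ))

/-- KL summand `a·log(a/c)`, with `0·log(0/c) = 0` and `a·log(a/0) = ⊤` for `a ≠ 0`. -/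
def klTerm (a c : ℝ) : EReal :=
  if a = 0 then 0 else if c = 0 then ⊤ else ((a * Real.log (a / c) : ℝ) : EReal)

/-- `d(μ, ν)`, the summed KL divergences, valued in `[0, +∞]`. -/
def dKL {n k : ℕ} (μ ν : Fin n → Fin k → ℝ) : EReal :=
  ∑ i, ∑ ℓ, klTerm (μ i ℓ) (ν i ℓ)

/-- Unnormalized one-coin Dawid–Skene score `N_{iℓ}`. -/
def Nds {n k p : ℕ} (h : Fin p → Fin n → Option (Fin k))
    (w : Fin k → ℝ) (β : Fin p → ℝ) (i : Fin n) (ℓ : Fin k) : ℝ :=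
  w ℓ * (∏ j ∈ Finset.univ.filter (fun j => h j i = some ℓ), β j)
    * ∏ j ∈ Finset.univ.filter (fun j => ∃ ℓ' ≠ ℓ, h j i = some ℓ'),
        (1 - β j) / ((k : ℝ) - 1)

/-- The one-coin Dawid–Skene prediction `g^{ds}(w, β)`. -/
def gds {n k p : ℕ} (h : Fin p → Fin n → Option (Fin k))
    (w : Fin k → ℝ) (β : Fin p → ℝ) (i : Fin n) (ℓ : Fin k) : ℝ :=
  Nds h w β i ℓ / ∑ ℓ', Nds h w β i ℓ'

/-- The real-valued `z · log g`. -/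
def realDotlog {n k : ℕ} (z g : Fin n → Fin k → ℝ) : ℝ :=
  ∑ i, ∑ ℓ, z i ℓ * Real.log (g i ℓ)

theorem EReal.coe_sum_sum {n k : ℕ} (f : Fin n → Fin k → ℝ) :
    ((∑ i, ∑ ℓ, f i ℓ : ℝ) : EReal) = ∑ i, ∑ ℓ, (f i ℓ : EReal) := by
  have key : ∀ {m : ℕ} (u : Fin m → ℝ), ((∑ i, u i : ℝ) : EReal) = ∑ i, (u i : EReal) :=
    fun u => map_sum (⟨⟨Real.toEReal, EReal.coe_zero⟩, EReal.coe_add⟩ : ℝ →+ EReal) u _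
  simp only [key]

theorem EReal.sum_eq_bot {ι : Type*} {s : Finset ι} {f : ι → EReal} {i : ι}
    (hi : i ∈ s) (h : f i = ⊥) : ∑ j ∈ s, f j = ⊥ := by
  rw [← Finset.add_sum_erase s f hi, h, EReal.bot_add]

theorem Simplex.le_one {n k : ℕ} {z : Fin n → Fin k → ℝ} (hz : z ∈ Simplex n k)
    (i : Fin n) (ℓ : Fin k) : z i ℓ ≤ 1 := by
  rw [← hz.2 i]
  exact Finset.single_le_sum (fun x _ => hz.1 i x) (Finset.mem_univ ℓ)

theorem dotlog_eq_coe {n k : ℕ} {z g : Fin n → Fin k → ℝ}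
    (hs : ∀ i ℓ, g i ℓ = 0 → z i ℓ = 0) : dotlog z g = (realDotlog z g : ℝ) := by
  rw [dotlog, realDotlog, EReal.coe_sum_sum]
  refine Finset.sum_congr rfl fun i _ => Finset.sum_congr rfl fun ℓ _ => ?_
  by_cases hg : g i ℓ = 0
  · simp [hs i ℓ hg]
  · simp [elog, hg]

theorem dotlog_eq_bot {n k : ℕ} {z g : Fin n → Fin k → ℝ} {i : Fin n} {ℓ : Fin k}
    (hg : g i ℓ = 0) (hz : 0 < z i ℓ) : dotlog z g = ⊥ := by
  refine EReal.sum_eq_bot (Finset.mem_univ i) (EReal.sum_eq_bot (Finset.mem_univ ℓ) ?_)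
  rw [elog, if_pos hg, EReal.coe_mul_bot_of_pos hz]

theorem dKL_eq_coe {n k : ℕ} {z g : Fin n → Fin k → ℝ}
    (hs : ∀ i ℓ, g i ℓ = 0 → z i ℓ = 0) :
    dKL z g = (realDotlog z z - realDotlog z g : ℝ) := by
  simp only [realDotlog, ← Finset.sum_sub_distrib]
  rw [dKL, EReal.coe_sum_sum]
  refine Finset.sum_congr rfl fun i _ => Finset.sum_congr rfl fun ℓ _ => ?_
  by_cases hz : z i ℓ = 0
  · simp [klTerm, hz]
  · have hg : g i ℓ ≠ 0 := fun hg => hz (hs i ℓ hg)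
    rw [klTerm, if_neg hz, if_neg hg, Real.log_div hz hg, mul_sub]

/-- Gibbs' inequality. -/
theorem realDotlog_le_self {n k : ℕ} {z g : Fin n → Fin k → ℝ}
    (hz : z ∈ Simplex n k) (hg : g ∈ Simplex n k) (hs : ∀ i ℓ, g i ℓ = 0 → z i ℓ = 0) :
    realDotlog z g ≤ realDotlog z z := by
  have hle : ∀ i ℓ, z i ℓ * Real.log (g i ℓ) - z i ℓ * Real.log (z i ℓ) ≤ g i ℓ - z i ℓ := by
    intro i ℓ
    rcases (hz.1 i ℓ).eq_or_lt with h0 | h0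
    · simpa [← h0] using hg.1 i ℓ
    · have hgp : 0 < g i ℓ := (hg.1 i ℓ).lt_of_ne' fun h => h0.ne' (hs i ℓ h)
      have hlog := mul_le_mul_of_nonneg_left
        (Real.log_le_sub_one_of_pos (div_pos hgp h0)) h0.le
      rw [Real.log_div hgp.ne' h0.ne', mul_sub, mul_sub, mul_div_cancel₀ _ h0.ne', mul_one] at hlog
      exact hlog
  have hsum : ∑ i, ∑ ℓ, (z i ℓ * Real.log (g i ℓ) - z i ℓ * Real.log (z i ℓ))
      ≤ ∑ i, ∑ ℓ, (g i ℓ - z i ℓ) :=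
    Finset.sum_le_sum fun i _ => Finset.sum_le_sum fun ℓ _ => hle i ℓ
  simp only [Finset.sum_sub_distrib, hz.2, hg.2, sub_self, Finset.sum_const_zero] at hsum
  unfold realDotlog
  linarith

theorem continuous_realDotlog_self {n k : ℕ} :
    Continuous fun z : Fin n → Fin k → ℝ => realDotlog z z := by
  refine continuous_finsetSum _ fun i _ => continuous_finsetSum _ fun ℓ _ => ?_
  exact Real.continuous_mul_log.comp (by fun_prop : Continuous fun z : Fin n → Fin k → ℝ => z i ℓ)

theorem convex_simplex (n k : ℕ) : Convex ℝ (Simplex n k) := by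
  intro x hx y hy s t hs ht hst
  refine ⟨fun i ℓ => ?_, fun i => ?_⟩
  · exact add_nonneg (mul_nonneg hs (hx.1 i ℓ)) (mul_nonneg ht (hy.1 i ℓ))
  · simp [Finset.sum_add_distrib, ← Finset.mul_sum, hx.2 i, hy.2 i, hst]

theorem isCompact_simplex (n k : ℕ) : IsCompact (Simplex n k) := by
  refine IsCompact.of_isClosed_subset
    (isCompact_univ_pi fun _ : Fin n => isCompact_univ_pi fun _ : Fin k =>
      (isCompact_Icc : IsCompact (Set.Icc (0 : ℝ) 1))) ?_
    fun z hz i _ ℓ _ => ⟨hz.1 i ℓ, Simplex.le_one hz i ℓ⟩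
  simp only [Simplex, Set.ofPred_and, Set.ofPred_forall]
  refine IsClosed.inter
    (isClosed_iInter fun i => isClosed_iInter fun ℓ => isClosed_le (by fun_prop) (by fun_prop))
    (isClosed_iInter fun i => isClosed_eq (by fun_prop) (by fun_prop))

theorem applyA_convexComb {n k p : ℕ} (h : Fin p → Fin n → Option (Fin k))
    (x y : Fin n → Fin k → ℝ) (s t : ℝ) (j : Fin p ⊕ Fin k) :
    applyA h (s • x + t • y) j = s * applyA h x j + t * applyA h y j := by
  simp only [applyA, Finset.mul_sum, ← Finset.sum_add_distrib, Pi.add_apply, Pi.smul_apply,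
    smul_eq_mul]
  refine Finset.sum_congr rfl fun i _ => Finset.sum_congr rfl fun ℓ _ => ?_
  ring

theorem convex_polytope {n k p : ℕ} (h : Fin p → Fin n → Option (Fin k))
    (b ε : Fin p ⊕ Fin k → ℝ) : Convex ℝ (Polytope h b ε) := by
  intro x hx y hy s t hs ht hst
  refine ⟨convex_simplex n k hx.1 hy.1 hs ht hst, fun j => ?_⟩
  rw [applyA_convexComb]
  exact (convex_Icc (b j - ε j) (b j + ε j)) (hx.2 j) (hy.2 j) hs ht hst

theorem isCompact_polytope {n k p : ℕ} (h : Fin p → Fin n → Option (Fin k))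
    (b ε : Fin p ⊕ Fin k → ℝ) : IsCompact (Polytope h b ε) := by
  refine (isCompact_simplex n k).inter_right (t := {z | ∀ j, b j - ε j ≤ applyA h z j ∧
    applyA h z j ≤ b j + ε j}) ?_
  have hc : ∀ j, Continuous fun z : Fin n → Fin k → ℝ => applyA h z j := by
    intro j
    unfold applyA
    fun_prop
  simp only [Set.ofPred_forall, Set.ofPred_and]
  exact isClosed_iInter fun j =>
    (isClosed_le continuous_const (hc j)).inter (isClosed_le (hc j) continuous_const)

/-- A minimizer of `z · log z` over a convex set satisfies the saddle-point inequality along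
segments. -/
theorem realDotlog_le_segment {n k : ℕ} {S : Set (Fin n → Fin k → ℝ)} (hS : S ⊆ Simplex n k)
    (hconv : Convex ℝ S) {y z : Fin n → Fin k → ℝ} (hy : y ∈ S) (hz : z ∈ S)
    (hmin : ∀ x ∈ S, realDotlog y y ≤ realDotlog x x) {t : ℝ} (ht : 0 < t) (ht1 : t < 1) :
    realDotlog y y ≤ realDotlog z ((1 - t) • y + t • z) := by
  set x := (1 - t) • y + t • z with hx
  have hxS : x ∈ S := hconv hy hz (by linarith) ht.le (by ring)
  have hsupp : ∀ i ℓ, x i ℓ = 0 → y i ℓ = 0 := by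
    intro i ℓ h0
    have h1 : (1 - t) * y i ℓ + t * z i ℓ = 0 := h0
    have hy0 := (hS hy).1 i ℓ
    have hz0 := mul_nonneg ht.le ((hS hz).1 i ℓ)
    by_contra hne
    have := mul_pos (sub_pos.2 ht1) (hy0.lt_of_ne' hne)
    linarith
  have hgibbs := realDotlog_le_self (hS hy) (hS hxS) hsupp
  have hsplit : realDotlog x x = (1 - t) * realDotlog y x + t * realDotlog z x := by
    simp only [realDotlog, Finset.mul_sum, ← Finset.sum_add_distrib]
    refine Finset.sum_congr rfl fun i _ => Finset.sum_congr rfl fun ℓ _ => ?_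
    have : x i ℓ = (1 - t) * y i ℓ + t * z i ℓ := rfl
    nth_rewrite 1 [this]
    ring
  have h1 := hmin x hxS
  have h2 := mul_le_mul_of_nonneg_left hgibbs (sub_pos.2 ht1).le
  rw [hsplit] at h1
  nlinarith

theorem realDotlog_le_term {n k : ℕ} {z g : Fin n → Fin k → ℝ}
    (hz : z ∈ Simplex n k) (hg : g ∈ Simplex n k) (i : Fin n) (ℓ : Fin k) :
    realDotlog z g ≤ z i ℓ * Real.log (g i ℓ) := by
  have hneg : ∀ i ℓ, z i ℓ * Real.log (g i ℓ) ≤ 0 := fun i ℓ =>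
    mul_nonpos_of_nonneg_of_nonpos (hz.1 i ℓ)
      (Real.log_nonpos (hg.1 i ℓ) (Simplex.le_one hg i ℓ))
  have h1 : realDotlog z g ≤ ∑ ℓ, z i ℓ * Real.log (g i ℓ) := by
    rw [realDotlog, ← Finset.add_sum_erase _ _ (Finset.mem_univ i)]
    exact add_le_of_nonpos_right
      (Finset.sum_nonpos fun i _ => Finset.sum_nonpos fun ℓ _ => hneg i ℓ)
  refine h1.trans ?_
  rw [← Finset.add_sum_erase _ _ (Finset.mem_univ ℓ)]
  exact add_le_of_nonpos_right (Finset.sum_nonpos fun ℓ _ => hneg i ℓ)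

theorem support_subset_of_minimizer {n k : ℕ} {S : Set (Fin n → Fin k → ℝ)}
    (hS : S ⊆ Simplex n k) (hconv : Convex ℝ S) {y z : Fin n → Fin k → ℝ} (hy : y ∈ S)
    (hz : z ∈ S) (hmin : ∀ x ∈ S, realDotlog y y ≤ realDotlog x x) (i : Fin n) (ℓ : Fin k)
    (h0 : y i ℓ = 0) : z i ℓ = 0 := by
  by_contra hne
  have hpos : 0 < z i ℓ := ((hS hz).1 i ℓ).lt_of_ne' hne
  have hlim : Filter.Tendsto (fun t : ℝ => z i ℓ * Real.log (t * z i ℓ))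
      (nhdsWithin 0 (Set.Ioi 0)) Filter.atBot := by
    refine Filter.Tendsto.const_mul_atBot hpos (Real.tendsto_log_nhdsGT_zero.comp ?_)
    refine tendsto_nhdsWithin_iff.2 ⟨?_, ?_⟩
    · have : Continuous fun t : ℝ => t * z i ℓ := by fun_prop
      simpa using (this.tendsto 0).mono_left nhdsWithin_le_nhds
    · filter_upwards [self_mem_nhdsWithin] with t ht using mul_pos ht hpos
  obtain ⟨t, hlt, ht⟩ := ((hlim.eventually_lt_atBot (realDotlog y y)).and
    (Ioo_mem_nhdsGT (zero_lt_one' ℝ))).exists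
  have h1 := realDotlog_le_segment hS hconv hy hz hmin ht.1 ht.2
  have h2 := realDotlog_le_term (hS hz)
    (hS (hconv hy hz (sub_pos.2 ht.2).le ht.1.le (by ring))) i ℓ
  simp only [Pi.add_apply, Pi.smul_apply, smul_eq_mul, h0, mul_zero, zero_add] at h2
  linarith

theorem realDotlog_le_of_minimizer {n k : ℕ} {S : Set (Fin n → Fin k → ℝ)}
    (hS : S ⊆ Simplex n k) (hconv : Convex ℝ S) {y z : Fin n → Fin k → ℝ} (hy : y ∈ S)
    (hz : z ∈ S) (hmin : ∀ x ∈ S, realDotlog y y ≤ realDotlog x x) :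
    realDotlog y y ≤ realDotlog z y := by
  have hsupp := support_subset_of_minimizer hS hconv hy hz hmin
  have hlim : Filter.Tendsto (fun t : ℝ => realDotlog z ((1 - t) • y + t • z))
      (nhdsWithin 0 (Set.Ioi 0)) (nhds (realDotlog z y)) := by
    refine tendsto_finsetSum _ fun i _ => tendsto_finsetSum _ fun ℓ _ => ?_
    by_cases hz0 : z i ℓ = 0
    · simp [hz0]
    · have hc : Continuous fun t : ℝ => ((1 - t) • y + t • z) i ℓ := by
        simp only [Pi.add_apply, Pi.smul_apply, smul_eq_mul]
        fun_prop
      have ht := (hc.tendsto 0).mono_left (nhdsWithin_le_nhds (s := Set.Ioi 0))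
      simp only [sub_zero, one_smul, zero_smul, add_zero] at ht
      exact (ht.log fun h => hz0 (hsupp i ℓ h)).const_mul _
  refine ge_of_tendsto hlim ?_
  filter_upwards [Ioo_mem_nhdsGT (zero_lt_one' ℝ)] with t ht
  exact realDotlog_le_segment hS hconv hy hz hmin ht.1 ht.2

theorem gexp_pos {n k p : ℕ} (h : Fin p → Fin n → Option (Fin k)) (θ : Fin p ⊕ Fin k → ℝ)
    (i : Fin n) (ℓ : Fin k) : 0 < gexp h θ i ℓ :=
  div_pos (Real.exp_pos _) (Finset.sum_pos (fun _ _ => Real.exp_pos _) ⟨ℓ, Finset.mem_univ ℓ⟩)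

theorem gexp_mem_simplex {n k p : ℕ} (hk : 0 < k) (h : Fin p → Fin n → Option (Fin k))
    (θ : Fin p ⊕ Fin k → ℝ) : gexp h θ ∈ Simplex n k := by
  refine ⟨fun i ℓ => (gexp_pos h θ i ℓ).le, fun i => ?_⟩
  simp only [gexp, ← Finset.sum_div]
  exact div_self (Finset.sum_pos (fun _ _ => Real.exp_pos _) ⟨⟨0, hk⟩, Finset.mem_univ _⟩).ne'

theorem realDotlog_gexp {n k p : ℕ} (h : Fin p → Fin n → Option (Fin k))
    (θ : Fin p ⊕ Fin k → ℝ) {z : Fin n → Fin k → ℝ} (hz : z ∈ Simplex n k) :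
    realDotlog z (gexp h θ) = ∑ j, θ j * applyA h z j
      - ∑ i, Real.log (∑ ℓ, Real.exp (avec h θ i ℓ)) := by
  have hlog : ∀ i ℓ, Real.log (gexp h θ i ℓ)
      = avec h θ i ℓ - Real.log (∑ ℓ', Real.exp (avec h θ i ℓ')) := fun i ℓ => by
    rw [gexp, Real.log_div (Real.exp_pos _).ne' (Finset.sum_pos (fun _ _ => Real.exp_pos _)
      ⟨ℓ, Finset.mem_univ ℓ⟩).ne', Real.log_exp]
  simp only [realDotlog, hlog, mul_sub, Finset.sum_sub_distrib, ← Finset.sum_mul, hz.2, one_mul]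
  congr 1
  simp only [avec, applyA, Finset.mul_sum]
  rw [Finset.sum_comm]
  simp_rw [Finset.sum_comm (s := (Finset.univ : Finset (Fin p ⊕ Fin k)))]
  rw [Finset.sum_comm]
  refine Finset.sum_congr rfl fun i _ => Finset.sum_congr rfl fun ℓ _ =>
    Finset.sum_congr rfl fun j _ => ?_
  ring

theorem sum_mul_applyA_sub_le {n k p : ℕ} {h : Fin p → Fin n → Option (Fin k)}
    {b ε : Fin p ⊕ Fin k → ℝ} {x y : Fin n → Fin k → ℝ} (hx : x ∈ Polytope h b ε)
    (hy : y ∈ Polytope h b ε) (θ : Fin p ⊕ Fin k → ℝ) :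
    ∑ j, θ j * applyA h x j - ∑ j, θ j * applyA h y j ≤ 2 * ∑ j, ε j * |θ j| := by
  rw [← Finset.sum_sub_distrib, Finset.mul_sum]
  refine Finset.sum_le_sum fun j _ => ?_
  have habs : |applyA h x j - applyA h y j| ≤ 2 * ε j := by
    rw [abs_le]
    constructor <;> linarith [(hx.2 j).1, (hx.2 j).2, (hy.2 j).1, (hy.2 j).2]
  calc θ j * applyA h x j - θ j * applyA h y j
      = θ j * (applyA h x j - applyA h y j) := by ring
    _ ≤ |θ j| * |applyA h x j - applyA h y j| := by
        rw [← abs_mul]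
        exact le_abs_self _
    _ ≤ |θ j| * (2 * ε j) := mul_le_mul_of_nonneg_left habs (abs_nonneg _)
    _ = 2 * (ε j * |θ j|) := by ring

/-- the BF error bound. -/
theorem stmt7 {n k p : ℕ} (hn : 0 < n) (hk : 2 ≤ k) (hp : 0 < p)
    (h : Fin p → Fin n → Option (Fin k)) (hnj : ∀ j, 0 < nRule h j)
    (η : Fin n → Fin k → ℝ) (hη : η ∈ Simplex n k)
    (b ε : Fin p ⊕ Fin k → ℝ)
    (hmem : ∀ j, b j - ε j ≤ applyA h η j ∧ applyA h η j ≤ b j + ε j)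
    (gbf : Fin n → Fin k → ℝ) (hgbf : gbf ∈ Simplex n k)
    (hopt : (⨅ z ∈ Polytope h b ε, dotlog z gbf)
        = ⨆ g ∈ Simplex n k, ⨅ z ∈ Polytope h b ε, dotlog z g)
    (θref : Fin p ⊕ Fin k → ℝ) :
    dKL η gbf ≤ -(⨅ z ∈ Polytope h b ε, dotlog z z) + dotlog η η
    ∧ -(⨅ z ∈ Polytope h b ε, dotlog z z) + dotlog η η
        ≤ dKL η (gexp h θref) + ((2 * ∑ j, ε j * |θref j| : ℝ) : EReal)
    ∧ dKL η (gexp h θref) + ((2 * ∑ j, ε j * |θref j| : ℝ) : EReal)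
        ≤ dKL η (gexp h θref) + ((2 * (⨆ j, ε j) * ∑ j, |θref j| : ℝ) : EReal) := by
  have hηP : η ∈ Polytope h b ε := ⟨hη, hmem⟩
  have hPS : Polytope h b ε ⊆ Simplex n k := fun z hz => hz.1
  obtain ⟨y, hy, hmin⟩ := (isCompact_polytope h b ε).exists_isMinOn ⟨η, hηP⟩
    continuous_realDotlog_self.continuousOn
  replace hmin : ∀ x ∈ Polytope h b ε, realDotlog y y ≤ realDotlog x x := fun x hx => hmin hx
  have hself : ∀ z : Fin n → Fin k → ℝ, dotlog z z = (realDotlog z z : ℝ) :=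
    fun z => dotlog_eq_coe fun _ _ hz => hz
  have hinf : (⨅ z ∈ Polytope h b ε, dotlog z z) = (realDotlog y y : ℝ) := by
    refine le_antisymm ((iInf₂_le y hy).trans (hself y).le) (le_iInf₂ fun z hz => ?_)
    rw [hself]
    exact_mod_cast hmin z hz
  have hrefsupp : ∀ i ℓ, gexp h θref i ℓ = 0 → ∀ z : Fin n → Fin k → ℝ, z i ℓ = 0 :=
    fun i ℓ h0 => absurd h0 (gexp_pos h θref i ℓ).ne'
  have hbf : ((realDotlog y y : ℝ) : EReal) ≤ dotlog η gbf :=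
    calc ((realDotlog y y : ℝ) : EReal) ≤ ⨅ z ∈ Polytope h b ε, dotlog z y := by
          refine le_iInf₂ fun z hz => ?_
          rw [dotlog_eq_coe (support_subset_of_minimizer hPS (convex_polytope h b ε) hy hz hmin)]
          exact_mod_cast realDotlog_le_of_minimizer hPS (convex_polytope h b ε) hy hz hmin
      _ ≤ ⨆ g ∈ Simplex n k, ⨅ z ∈ Polytope h b ε, dotlog z g :=
          le_iSup₂ (f := fun g (_ : g ∈ Simplex n k) => ⨅ z ∈ Polytope h b ε, dotlog z g) y hy.1
      _ = ⨅ z ∈ Polytope h b ε, dotlog z gbf := hopt.symm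
      _ ≤ dotlog η gbf := iInf₂_le η hηP
  have hbfsupp : ∀ i ℓ, gbf i ℓ = 0 → η i ℓ = 0 := by
    intro i ℓ h0
    by_contra hne
    rw [dotlog_eq_bot h0 ((hη.1 i ℓ).lt_of_ne' hne), le_bot_iff] at hbf
    exact EReal.coe_ne_bot _ hbf
  rw [dotlog_eq_coe hbfsupp, EReal.coe_le_coe_iff] at hbf
  rw [hinf, hself, dKL_eq_coe hbfsupp, dKL_eq_coe fun i ℓ h0 => hrefsupp i ℓ h0 η]
  norm_cast
  refine ⟨by linarith, ?_, ?_⟩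
  · have hgibbs := realDotlog_le_self hy.1 (gexp_mem_simplex (by omega) h θref)
      fun i ℓ h0 => hrefsupp i ℓ h0 y
    rw [realDotlog_gexp h θref hy.1] at hgibbs
    rw [realDotlog_gexp h θref hη]
    linarith [sum_mul_applyA_sub_le hηP hy θref]
  · have hsup : ∑ j, ε j * |θref j| ≤ (⨆ j, ε j) * ∑ j, |θref j| := by
      rw [Finset.mul_sum]
      exact Finset.sum_le_sum fun j _ => mul_le_mul_of_nonneg_right
        (le_ciSup (Set.finite_range ε).bddAbove j) (abs_nonneg _)
    linarith
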